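/- Let A be a commutative Noetherian ring, let T and Z be schemes each equipped with a proper morphism to Spec A, and let i : T → Z be a morphism of schemes over Spec A. Suppose that for every maximal ideal 𝔪 of A the base change of i along Spec(A/𝔪) → Spec A (the induced morphism between the fibres over the closed point corresponding to 𝔪) is a closed immersion. Then i is a closed immersion. -/

import Mathlib

open AlgebraicGeometry CategoryTheory Limits

/-- Nakayama: a finite ring map that is surjective modulo `J` is surjective up to an element
congruent to `1` modulo `J`. -/
lemma aux_nakayama {B C : Type*} [CommRing B] [CommRing C] (φ : B →+* C) (hφ : φ.Finite)
    (J : Ideal B) (hJ : ∀ c, ∃ b, c - φ b ∈ J.map φ) :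
    ∃ b, b - 1 ∈ J ∧ ∀ c, ∃ b', φ b * c = φ b' := by
  algebraize [φ]
  have key : (⊤ : Submodule B (C ⧸ (1 : Submodule B C))) ≤ J • ⊤ := by
    rintro x -
    obtain ⟨c, rfl⟩ := Submodule.Quotient.mk_surjective _ x
    obtain ⟨b, hb⟩ := hJ c
    have h1 : c - φ b ∈ J • (⊤ : Submodule B C) := by
      rw [Ideal.smul_top_eq_map]; exact hb
    have h2 := Submodule.mem_map_of_mem (f := (1 : Submodule B C).mkQ) h1
    rw [Submodule.map_smul''] at h2
    have h3 : (1 : Submodule B C).mkQ (c - φ b) = Submodule.Quotient.mk c := by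
      have h4 : (1 : Submodule B C).mkQ (φ b) = 0 := by
        simp only [Submodule.mkQ_apply, Submodule.Quotient.mk_eq_zero]
        exact Submodule.mem_one.mpr ⟨b, rfl⟩
      rw [map_sub, h4, sub_zero]
      rfl
    rw [h3] at h2
    exact Submodule.smul_mono le_rfl le_top h2
  obtain ⟨r, hr, h⟩ := Submodule.exists_sub_one_mem_and_smul_eq_zero_of_fg_of_le_smul J ⊤
    Module.Finite.fg_top key
  refine ⟨r, hr, fun c ↦ ?_⟩
  have := h (Submodule.Quotient.mk c) trivial
  rw [← Submodule.Quotient.mk_smul, Submodule.Quotient.mk_eq_zero, Submodule.mem_one] at this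
  obtain ⟨b', hb'⟩ := this
  exact ⟨b', by rw [Algebra.smul_def] at hb'; exact hb'.symm⟩

lemma aux_away {B C B' C' : Type*} [CommRing B] [CommRing C] [CommRing B'] [CommRing C']
    [Algebra B B'] [Algebra C C'] (φ : B →+* C) (b : B) [IsLocalization.Away b B']
    [IsLocalization.Away (φ b) C'] (h : ∀ c, ∃ b', φ b * c = φ b') :
    Function.Surjective (IsLocalization.Away.map B' C' φ b) := by
  intro x
  obtain ⟨n, c, hc⟩ := IsLocalization.Away.surj (φ b) x
  obtain ⟨b', hb'⟩ := h c
  have hu : IsUnit (algebraMap C C' (φ b)) := IsLocalization.Away.algebraMap_isUnit _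
  have hu' : IsUnit (algebraMap B B' b) := IsLocalization.Away.algebraMap_isUnit _
  obtain ⟨v, hv⟩ := hu'.exists_left_inv
  refine ⟨algebraMap _ _ b' * v ^ (n + 1), ?_⟩
  have e (y) : IsLocalization.Away.map B' C' φ b (algebraMap B B' y) = algebraMap C C' (φ y) := by
    simp [IsLocalization.Away.map]
  apply (hu.pow (n + 1)).mul_left_injective
  dsimp only
  have e2 : IsLocalization.Away.map B' C' φ b v * algebraMap C C' (φ b) = 1 := by
    rw [← e, ← map_mul, hv, map_one]
  rw [map_mul, map_pow, mul_assoc, ← mul_pow, e2, e, ← hb', map_mul, ← hc]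
  ring

lemma aux_quot {B C : CommRingCat.{0}} (φ : B ⟶ C) (J : Ideal B)
    (h : IsClosedImmersion (pullback.snd (Spec.map φ)
      (Spec.map (CommRingCat.ofHom (Ideal.Quotient.mk J))))) :
    ∀ c, ∃ b, c - φ b ∈ J.map φ.hom := by
  let q : B ⟶ CommRingCat.of (B ⧸ J) := CommRingCat.ofHom (Ideal.Quotient.mk J)
  let q' : C ⟶ CommRingCat.of (C ⧸ J.map φ.hom) := CommRingCat.ofHom (Ideal.Quotient.mk _)
  let r : CommRingCat.of (B ⧸ J) ⟶ CommRingCat.of (C ⧸ J.map φ.hom) :=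
    CommRingCat.ofHom (Ideal.quotientMap _ φ.hom Ideal.le_comap_map)
  have hr : φ ≫ q' = q ≫ r := by ext; simp [q, q', r]
  have hp := isPullback_SpecMap_pushout φ q
  have hc : IsClosedImmersion (Spec.map (pushout.inr φ q)) := by
    rw [← hp.isoPullback_hom_snd]
    exact (MorphismProperty.cancel_left_of_respectsIso @IsClosedImmersion _ _).mpr h
  have hs := (IsClosedImmersion.isAffine_surjective_of_isAffine (Spec.map (pushout.inr φ q))).2
  have hs' : Function.Surjective (pushout.inr φ q) := by
    have := Scheme.ΓSpecIso_naturality (pushout.inr φ q)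
    have h2 : pushout.inr φ q = (Scheme.ΓSpecIso _).inv ≫ (Spec.map (pushout.inr φ q)).appTop ≫
      (Scheme.ΓSpecIso _).hom := by rw [this]; simp
    rw [h2]
    simp only [CommRingCat.hom_comp, RingHom.coe_comp]
    exact ((ConcreteCategory.bijective_of_isIso _).2.comp hs).comp
      (ConcreteCategory.bijective_of_isIso _).2
  intro c
  obtain ⟨y, hy⟩ := hs' (pushout.inl φ q c)
  obtain ⟨b, rfl⟩ := Ideal.Quotient.mk_surjective y
  refine ⟨b, ?_⟩
  have e1 : pushout.desc q' r hr (pushout.inr φ q (Ideal.Quotient.mk J b)) =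
      r (Ideal.Quotient.mk J b) :=
    congr($(pushout.inr_desc q' r hr) (Ideal.Quotient.mk J b))
  have e2 : pushout.desc q' r hr (pushout.inl φ q c) = q' c :=
    congr($(pushout.inl_desc q' r hr) c)
  have : r (Ideal.Quotient.mk J b) = q' c := by rw [← e1, ← e2, hy]
  rw [← Ideal.Quotient.eq]
  have h4 : r (Ideal.Quotient.mk J b) = Ideal.Quotient.mk _ (φ b) := by simp [r]
  exact this.symm.trans h4

lemma aux_local {T Z : Scheme.{0}} (P : MorphismProperty Scheme.{0}) [IsZariskiLocalAtTarget P]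
    [CompactSpace Z] (i : T ⟶ Z)
    (h : ∀ z : Z, IsClosed {z} → ∃ V : Z.Opens, z ∈ V ∧ P (i ∣_ V)) : P i := by
  refine IsZariskiLocalAtTarget.of_iSup_eq_top
    (fun V : {V : Z.Opens // P (i ∣_ V)} ↦ V.1) ?_ (fun V ↦ V.2)
  by_contra hne
  set W : Z.Opens := ⨆ V : {V : Z.Opens // P (i ∣_ V)}, V.1 with hW
  have hne' : ((W : Set Z)ᶜ).Nonempty := by
    rw [Set.nonempty_compl]
    exact fun h ↦ hne (TopologicalSpace.Opens.ext h)
  obtain ⟨z, hz, hcl⟩ := W.isOpen.isClosed_compl.exists_closed_singleton hne'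
  obtain ⟨V, hzV, hV⟩ := h z hcl
  exact hz (le_iSup (fun V : {V : Z.Opens // P (i ∣_ V)} ↦ V.1) ⟨V, hV⟩ hzV)

/-- If `i` is finite, `U` affine, and the base change of `i` to `V(J) ⊆ U` is a closed immersion,
then `i` is a closed immersion near each point of `V(J)`. -/
lemma aux_finite {T Z : Scheme.{0}} (i : T ⟶ Z) [IsFinite i] (U : Z.Opens) (hU : IsAffineOpen U)
    (J : Ideal Γ(Z, U))
    (h : IsClosedImmersion (pullback.snd i
      (Spec.map (CommRingCat.ofHom (Ideal.Quotient.mk J)) ≫ hU.fromSpec)))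
    (z : Z) (hz : z ∈ U) (hJ : J ≤ (hU.primeIdealOf ⟨z, hz⟩).asIdeal) :
    ∃ V : Z.Opens, z ∈ V ∧ IsClosedImmersion (i ∣_ V) := by
  have hU' : IsAffineOpen (i ⁻¹ᵁ U) := hU.preimage i
  have sq : IsPullback hU'.fromSpec (Spec.map (i.app U)) i hU.fromSpec := by
    refine (IsOpenImmersion.isPullback _ _ _ _ ?_ ?_).flip
    · rw [Scheme.Hom.app_eq_appLE, hU.SpecMap_appLE_fromSpec _ hU']
    · simp
  have h2 : IsClosedImmersion (pullback.snd (Spec.map (i.app U))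
      (Spec.map (CommRingCat.ofHom (Ideal.Quotient.mk J)))) := by
    have := ((IsPullback.of_hasPullback (Spec.map (i.app U))
      (Spec.map (CommRingCat.ofHom (Ideal.Quotient.mk J)))).flip.paste_vert sq.flip).flip
    rw [← this.isoPullback_hom_snd]
    exact (MorphismProperty.cancel_left_of_respectsIso @IsClosedImmersion _ _).mpr h
  obtain ⟨b, hb, hb'⟩ := aux_nakayama (i.app U).hom (IsFinite.finite_app i U hU) J (aux_quot _ _ h2)
  refine ⟨Z.basicOpen b, ?_, ?_⟩
  · have : hU.primeIdealOf ⟨z, hz⟩ ∈ hU.fromSpec ⁻¹ᵁ Z.basicOpen b := by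
      rw [hU.fromSpec_preimage_basicOpen]
      intro hmem
      refine (hU.primeIdealOf ⟨z, hz⟩).2.ne_top ((Ideal.eq_top_iff_one _).mpr ?_)
      simpa using sub_mem hmem (hJ hb)
    have h3 : hU.fromSpec (hU.primeIdealOf ⟨z, hz⟩) = z := hU.fromSpec_primeIdealOf ⟨z, hz⟩
    rw [← h3]
    exact this
  · have hD := hU.basicOpen b
    have : IsAffine (Z.basicOpen b) := hD
    have : IsAffine (i ⁻¹ᵁ Z.basicOpen b) := hD.preimage i
    apply IsClosedImmersion.of_surjective_of_isAffine
    have := hU.isLocalization_basicOpen b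
    have := hU'.isLocalization_basicOpen (i.app U b)
    have hs : Function.Surjective (i.app (Z.basicOpen b)) := by
      rw [hU.app_basicOpen_eq_away_map i hU' b]
      simp only [CommRingCat.hom_comp, RingHom.coe_comp, CommRingCat.hom_ofHom]
      exact (ConcreteCategory.bijective_of_isIso _).2.comp (aux_away _ _ hb')
    have hs2 : Function.Surjective (i.app ((Z.basicOpen b).ι ''ᵁ ⊤)) := by
      rw [Scheme.Opens.ι_image_top]
      exact hs
    rw [morphismRestrict_appTop]
    exact (ConcreteCategory.bijective_of_isIso (T.presheaf.map (eqToHom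
      (image_morphismRestrict_preimage i (Z.basicOpen b) ⊤)).op)).2.comp hs2

theorem statement1 {A : Type} [CommRing A] [IsNoetherianRing A]
    (T Z : Scheme) (fT : T ⟶ Spec (CommRingCat.of A)) (fZ : Z ⟶ Spec (CommRingCat.of A))
    [IsProper fT] [IsProper fZ]
    (i : T ⟶ Z) (hi : i ≫ fZ = fT)
    (h : ∀ 𝔪 : Ideal A, 𝔪.IsMaximal →
      IsClosedImmersion
        (pullback.map fT (Spec.map (CommRingCat.ofHom (Ideal.Quotient.mk 𝔪)))
          fZ (Spec.map (CommRingCat.ofHom (Ideal.Quotient.mk 𝔪)))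
          i (𝟙 _) (𝟙 _) (by simp [hi]) (by simp))) :
    IsClosedImmersion i := by
  have : IsProper (i ≫ fZ) := hi ▸ inferInstance
  have : IsProper i := IsProper.of_comp i fZ
  have : CompactSpace Z := QuasiCompact.compactSpace_of_compactSpace fZ
  -- base change along anything over a closed point
  have key (𝔪 : Ideal A) (h𝔪 : 𝔪.IsMaximal) (R : CommRingCat.{0}) (g : Spec R ⟶ Z)
      (ψ : CommRingCat.of A ⟶ R) (hψ : g ≫ fZ = Spec.map ψ) (hk : ∀ a ∈ 𝔪, ψ a = 0) :
      IsClosedImmersion (pullback.snd i g) := by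
    let q : CommRingCat.of A ⟶ CommRingCat.of (A ⧸ 𝔪) := CommRingCat.ofHom (Ideal.Quotient.mk 𝔪)
    let r : CommRingCat.of (A ⧸ 𝔪) ⟶ R := CommRingCat.ofHom (Ideal.Quotient.lift 𝔪 ψ.hom hk)
    have hr : q ≫ r = ψ := by ext; simp [q, r]
    have hm := h 𝔪 h𝔪
    let g' : Spec R ⟶ pullback fZ (Spec.map q) :=
      pullback.lift g (Spec.map r) (by rw [hψ, ← Spec.map_comp, hr])
    let m := pullback.map fT (Spec.map q) fZ (Spec.map q) i (𝟙 _) (𝟙 _) (by simp [hi]) (by simp)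
    have hm : IsClosedImmersion m := hm
    have sq : IsPullback (pullback.fst fT (Spec.map q)) m i (pullback.fst fZ (Spec.map q)) := by
      have t := IsPullback.of_hasPullback fZ (Spec.map q)
      have s : IsPullback (pullback.fst fT (Spec.map q)) (m ≫ pullback.snd _ _) (i ≫ fZ)
          (Spec.map q) := by
        simp only [m, pullback.lift_snd, pullback.map, Category.comp_id, hi]
        exact IsPullback.of_hasPullback _ _
      exact IsPullback.of_bot s (pullback.lift_fst _ _ _).symm t
    have sq2 := ((IsPullback.of_hasPullback m g').flip.paste_vert sq.flip).flip
    have e : g' ≫ pullback.fst fZ (Spec.map q) = g := pullback.lift_fst _ _ _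
    rw [e] at sq2
    rw [← sq2.isoPullback_inv_snd]
    infer_instance
  have hmax (z : Z) (hz : IsClosed {z}) : (fZ z).asIdeal.IsMaximal := by
    refine (PrimeSpectrum.isClosed_singleton_iff_isMaximal (R := A) (fZ z)).mp ?_
    simpa using! fZ.isClosedMap _ hz
  have hfin : IsFinite i := by
    suffices LocallyQuasiFinite i from IsFinite.of_isProper_of_locallyQuasiFinite i
    have : IsZariskiLocalAtTarget @LocallyQuasiFinite.{0} :=
      HasRingHomProperty.instIsZariskiLocalAtTarget (P := @LocallyQuasiFinite.{0})
        (Q := RingHom.QuasiFinite)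
    apply aux_local @LocallyQuasiFinite
    intro z hz
    suffices (i ⁻¹' {z}).Finite by
      obtain ⟨V, hzV, hV⟩ :=
        exists_isFinite_morphismRestrict_of_finite_preimage_singleton i z this
      exact ⟨V, hzV, inferInstance⟩
    obtain ⟨ψ, hψ⟩ := Spec.map_surjective (Z.fromSpecResidueField z ≫ fZ)
    have := key _ (hmax z hz) _ (Z.fromSpecResidueField z) ψ hψ.symm (by
      intro a ha
      have h3 : fZ z = Spec.map ψ (⊥ : PrimeSpectrum (Z.residueField z)) := by
        rw [hψ]
        exact congr(fZ $(Z.fromSpecResidueField_apply z _)).symm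
      rw [h3] at ha
      exact ha)
    have h2 : IsClosedImmersion (i.fiberToSpecResidueField z) := this
    have : Finite (i.fiber z) := Finite.of_injective _
      (i.fiberToSpecResidueField z).isClosedEmbedding.injective
    exact (i.fiberHomeo z).finite_iff.mp this
  apply aux_local @IsClosedImmersion
  intro z hz
  obtain ⟨_, ⟨U, (hU : IsAffineOpen U), rfl⟩, hzU, -⟩ := Z.isBasis_affineOpens.exists_subset_of_mem_open
    (Set.mem_univ z) isOpen_univ
  obtain ⟨χ, hχ⟩ := Spec.map_surjective (hU.fromSpec ≫ fZ)
  refine aux_finite i U hU ((fZ z).asIdeal.map χ.hom) ?_ z hzU ?_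
  · refine key _ (hmax z hz) _ _ (χ ≫ CommRingCat.ofHom (Ideal.Quotient.mk _)) ?_ ?_
    · rw [Category.assoc, ← hχ, ← Spec.map_comp]
    · intro a ha
      exact Ideal.Quotient.eq_zero_iff_mem.mpr (Ideal.mem_map_of_mem _ ha)
  · rw [Ideal.map_le_iff_le_comap]
    have h3 : fZ z = Spec.map χ (hU.primeIdealOf ⟨z, hzU⟩) := by
      rw [hχ]
      exact congr(fZ $(hU.fromSpec_primeIdealOf ⟨z, hzU⟩)).symm
    rw [h3]
    exact le_rfl
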